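/- Let A_n be the free associative unital ℂ-algebra on generators x_1,…,x_n and fix i ≥ 2. Then there exists N ≥ 1 such that the N-th power of the ideal M_2(A_n) is contained in M_i(A_n); equivalently, the image of M_2(A_n) in Q_{n,i} = A_n/M_i(A_n) is a nilpotent ideal. -/

import Mathlib

noncomputable section

/-- `lcs k A n` is the `(n+1)`-st term `L_{n+1}(A)` of the lower central series of `A`
regarded as a Lie algebra under the commutator `[a,b] = a*b - b*a`:
`lcs k A 0 = L_1(A) = A` and `L_{n+2}(A) = span [A, L_{n+1}(A)]`. -/
def lcs (k A : Type*) [Field k] [Ring A] [Algebra k A] : ℕ → Submodule k A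
  | 0 => ⊤
  | n + 1 => Submodule.span k {x | ∃ a : A, ∃ b ∈ lcs k A n, x = a * b - b * a}

/-- `Lser k A i = L_i(A)` for `i ≥ 1`. -/
def Lser (k A : Type*) [Field k] [Ring A] [Algebra k A] (i : ℕ) : Submodule k A :=
  lcs k A (i - 1)

/-- The two-sided ideal of `A` generated by a set `S`, as a `k`-submodule. -/
def idealGen (k : Type*) {A : Type*} [Field k] [Ring A] [Algebra k A] (S : Set A) :
    Submodule k A :=
  Submodule.span k {x | ∃ a b : A, ∃ s ∈ S, x = a * s * b}

/-- `Mser k A i = M_i(A)`, the two-sided ideal of `A` generated by `L_i(A)`. -/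
def Mser (k A : Type*) [Field k] [Ring A] [Algebra k A] (i : ℕ) : Submodule k A :=
  idealGen k (Lser k A i : Set A)

section IdealGen

variable {k A : Type*} [Field k] [Ring A] [Algebra k A]

theorem subset_idealGen (S : Set A) : S ⊆ idealGen k S :=
  fun s hs => Submodule.subset_span ⟨1, 1, s, hs, by simp⟩

theorem mul_mem_idealGen_left {S : Set A} (c : A) {x : A} (hx : x ∈ idealGen k S) :
    c * x ∈ idealGen k S := by
  induction hx using Submodule.span_induction with
  | mem x hx =>
    obtain ⟨a, b, s, hs, rfl⟩ := hx
    exact Submodule.subset_span ⟨c * a, b, s, hs, by simp only [mul_assoc]⟩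
  | zero => simp
  | add x y _ _ hx hy => rw [mul_add]; exact add_mem hx hy
  | smul r x _ hx => rw [mul_smul_comm]; exact Submodule.smul_mem _ _ hx

theorem mul_mem_idealGen_right {S : Set A} (c : A) {x : A} (hx : x ∈ idealGen k S) :
    x * c ∈ idealGen k S := by
  induction hx using Submodule.span_induction with
  | mem x hx =>
    obtain ⟨a, b, s, hs, rfl⟩ := hx
    exact Submodule.subset_span ⟨a, b * c, s, hs, by simp only [mul_assoc]⟩
  | zero => simp
  | add x y _ _ hx hy => rw [add_mul]; exact add_mem hx hy
  | smul r x _ hx => rw [smul_mul_assoc]; exact Submodule.smul_mem _ _ hx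

variable (k) in
/-- `idealGen k S` as a left ideal; it is two-sided. -/
def idealGenIdeal (S : Set A) : Ideal A where
  carrier := idealGen k S
  add_mem' := add_mem
  zero_mem' := zero_mem _
  smul_mem' c _ hx := mul_mem_idealGen_left c hx

theorem mem_idealGenIdeal {S : Set A} {x : A} : x ∈ idealGenIdeal k S ↔ x ∈ idealGen k S :=
  Iff.rfl

instance (S : Set A) : (idealGenIdeal k S).IsTwoSided :=
  ⟨fun c hx => mul_mem_idealGen_right c hx⟩

theorem commutator_mem_lcs_succ (a : A) {b : A} {n : ℕ} (hb : b ∈ lcs k A n) :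
    a * b - b * a ∈ lcs k A (n + 1) :=
  Submodule.subset_span ⟨a, b, hb, rfl⟩

end IdealGen

section CommutatorIdentities

variable {R : Type*} [Ring R]

/-- If `[·, w]` takes values in the center of `R`, then `[a, c][b, w] + [a, w][b, c] = 0`. -/
theorem commutator_mul_add_commutator_mul_eq_zero {w : R}
    (hw : ∀ d r : R, Commute (d * w - w * d) r) (a b c : R) :
    (a * c - c * a) * (b * w - w * b) + (a * w - w * a) * (b * c - c * b) = 0 := by
  have hab := (hw (a * b) c).eq
  have ha := (hw a c).eq
  have hb := (hw b c).eq
  have key : a * b * w - w * (a * b) = a * (b * w - w * b) + (a * w - w * a) * b := by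
    noncomm_ring
  rw [key] at hab
  calc _ = (a * (b * w - w * b) + (a * w - w * a) * b) * c
          - c * (a * (b * w - w * b) + (a * w - w * a) * b)
          - a * ((b * w - w * b) * c - c * (b * w - w * b))
          - ((a * w - w * a) * c - c * (a * w - w * a)) * b := by noncomm_ring
    _ = 0 := by rw [hab, ha, hb]; simp

/-- If `[·, w]` takes values in the center of `R`, then `[a, [b, c]][d, w] = 0`. -/
theorem double_commutator_mul_eq_zero {w : R}
    (hw : ∀ d r : R, Commute (d * w - w * d) r) (a b c d : R) :
    (a * (b * c - c * b) - (b * c - c * b) * a) * (d * w - w * d) = 0 := by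
  have h := commutator_mul_add_commutator_mul_eq_zero hw (b * c - c * b) d a
  have hbc : (b * c - c * b) * w - w * (b * c - c * b) = 0 := by
    calc _ = ((b * w - w * b) * c - c * (b * w - w * b))
            - ((c * w - w * c) * b - b * (c * w - w * c)) := by noncomm_ring
      _ = 0 := by rw [(hw b c).eq, (hw c b).eq]; simp
  rw [hbc, zero_mul, add_zero] at h
  rw [← neg_sub ((b * c - c * b) * a), neg_mul, h, neg_zero]

/-- If all commutators of `R` are central, then they square to zero. -/
theorem commutator_sq_eq_zero (hR : ∀ a b r : R, Commute (a * b - b * a) r) (a b : R) :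
    (a * b - b * a) ^ 2 = 0 := by
  have h := commutator_mul_add_commutator_mul_eq_zero (fun d => hR d b) a b a
  rw [sub_self, zero_mul, zero_add, ← neg_sub (a * b), mul_neg, neg_eq_zero] at h
  rw [sq, h]

end CommutatorIdentities

section FinitelyGenerated

variable {k R : Type*} [Field k] [Ring R] [Algebra k R]

/-- If a two-sided ideal contains the commutators of a generating set with `t`,
it contains all commutators with `t`. -/
theorem commutator_mem_of_adjoin_eq_top {S : Submodule k R} {X : Set R}
    (hX : Algebra.adjoin k X = ⊤) (hl : ∀ c, ∀ x ∈ S, c * x ∈ S) (hr : ∀ c, ∀ x ∈ S, x * c ∈ S)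
    {t : R} (ht : ∀ x ∈ X, x * t - t * x ∈ S) (a : R) : a * t - t * a ∈ S := by
  have ha : a ∈ Algebra.adjoin k X := hX ▸ Algebra.mem_top
  induction ha using Algebra.adjoin_induction with
  | mem x hx => exact ht x hx
  | algebraMap r => rw [Algebra.commutes r t, sub_self]; exact zero_mem S
  | add x y _ _ hx hy =>
    convert add_mem hx hy using 1
    noncomm_ring
  | mul x y _ _ hx hy =>
    convert add_mem (hl x _ hy) (hr y _ hx) using 1
    noncomm_ring

/-- In a finitely generated algebra whose commutators are central, all commutators lie in
a nilpotent two-sided ideal. -/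
theorem exists_nilpotent_of_commute_commutator {ι : Type*} [Fintype ι] {x : ι → R}
    (hx : Algebra.adjoin k (Set.range x) = ⊤) (hR : ∀ a b r : R, Commute (a * b - b * a) r) :
    ∃ S : Submodule k R, IsNilpotent S ∧ (∀ c, ∀ y ∈ S, c * y ∈ S) ∧ (∀ c, ∀ y ∈ S, y * c ∈ S) ∧
      ∀ a b : R, a * b - b * a ∈ S := by
  let c : ι × ι → Submodule k R := fun p =>
    Submodule.span k {x p.1 * x p.2 - x p.2 * x p.1}
  have hc (p : ι × ι) (T : Submodule k R) : Commute (c p) T :=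
    le_antisymm
      (Submodule.mul_le.2 fun a ha b hb => by
        obtain ⟨r, rfl⟩ := Submodule.mem_span_singleton.1 ha
        rw [((hR _ _ b).smul_left r).eq]
        exact Submodule.mul_mem_mul hb ha)
      (Submodule.mul_le.2 fun b hb a ha => by
        obtain ⟨r, rfl⟩ := Submodule.mem_span_singleton.1 ha
        rw [← ((hR _ _ b).smul_left r).eq]
        exact Submodule.mul_mem_mul ha hb)
  have hsq (p : ι × ι) : c p ^ 2 = 0 := by
    rw [Submodule.span_pow, Set.singleton_pow, commutator_sq_eq_zero hR]
    simp
  let S : Submodule k R := ∑ p, ⊤ * c p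
  have hS : ⊤ * S ≤ S := by
    simp only [S, Finset.mul_sum, ← mul_assoc]
    exact Finset.sum_le_sum fun p _ => mul_le_mul_left le_top _
  have hST : S * ⊤ = ⊤ * S := by
    simp only [S, Finset.mul_sum, Finset.sum_mul, mul_assoc, (hc _ ⊤).eq]
  have hl (a y : R) (hy : y ∈ S) : a * y ∈ S :=
    hS (Submodule.mul_mem_mul Submodule.mem_top hy)
  have hr (a y : R) (hy : y ∈ S) : y * a ∈ S :=
    hS (hST ▸ Submodule.mul_mem_mul hy Submodule.mem_top)
  refine ⟨S, ?_, hl, hr, fun a b => ?_⟩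
  · refine Commute.isNilpotent_sum (fun p _ => ?_) fun p q _ _ => ?_
    · exact (hc p ⊤).symm.isNilpotent_mul_left ⟨2, hsq p⟩
    · exact Commute.mul_left (Commute.mul_right rfl (hc q ⊤).symm) (hc p _)
  · refine commutator_mem_of_adjoin_eq_top hx hl hr ?_ a
    rintro _ ⟨i, rfl⟩
    rw [← neg_sub]
    refine neg_mem (commutator_mem_of_adjoin_eq_top hx hl hr ?_ b)
    rintro _ ⟨j, rfl⟩
    have hji : x j * x i - x i * x j ∈ ⊤ * c (j, i) := by
      simpa using Submodule.mul_mem_mul (Submodule.mem_top (x := (1 : R)))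
        (Submodule.mem_span_singleton_self (R := k) (x j * x i - x i * x j))
    exact (Finset.single_le_sum (f := fun p => (⊤ : Submodule k R) * c p)
      (fun _ _ => bot_le) (Finset.mem_univ (j, i))) hji

end FinitelyGenerated

section Mser

variable {k A : Type*} [Field k] [Ring A] [Algebra k A]

theorem mul_mem_idealGen_of_lcs {n : ℕ} {s z : A} (hs : s ∈ lcs k A 2)
    (hz : z ∈ lcs k A (n + 1)) : s * z ∈ idealGen k (lcs k A (n + 2) : Set A) := by
  let π := Ideal.Quotient.mk (idealGenIdeal k (lcs k A (n + 2) : Set A))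
  induction hz using Submodule.span_induction with
  | zero => simp
  | add x y _ _ hx hy => rw [mul_add]; exact add_mem hx hy
  | smul r x _ hx => rw [mul_smul_comm]; exact Submodule.smul_mem _ _ hx
  | mem z hz =>
    obtain ⟨d, w, hw, rfl⟩ := hz
    have hcomm : ∀ d r, Commute (d * π w - π w * d) r := by
      intro d r
      obtain ⟨d, rfl⟩ := Ideal.Quotient.mk_surjective d
      obtain ⟨r, rfl⟩ := Ideal.Quotient.mk_surjective r
      refine Commute.symm (sub_eq_zero.1 ?_)
      simp only [π, ← map_mul, ← map_sub]
      exact Ideal.Quotient.eq_zero_iff_mem.2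
        (subset_idealGen _ (commutator_mem_lcs_succ r (commutator_mem_lcs_succ d hw)))
    induction hs using Submodule.span_induction with
    | zero => simp
    | add x y _ _ hx hy => rw [add_mul]; exact add_mem hx hy
    | smul r x _ hx => rw [smul_mul_assoc]; exact Submodule.smul_mem _ _ hx
    | mem s hs =>
      obtain ⟨a, t, ht, rfl⟩ := hs
      induction ht using Submodule.span_induction with
      | zero => simp
      | add x y _ _ hx hy =>
        convert add_mem hx hy using 1
        noncomm_ring
      | smul r x _ hx =>
        convert Submodule.smul_mem _ r hx using 1
        simp only [mul_smul_comm, smul_mul_assoc, ← smul_sub]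
      | mem t ht =>
        obtain ⟨b, c, -, rfl⟩ := ht
        refine mem_idealGenIdeal.1 (Ideal.Quotient.eq_zero_iff_mem.1 ?_)
        simpa using double_commutator_mul_eq_zero hcomm (π a) (π b) (π c) (π d)

theorem Mser_three_mul_Mser_le (n : ℕ) :
    Mser k A 3 * Mser k A (n + 2) ≤ Mser k A (n + 3) := by
  refine Submodule.span_mul_span k _ _ |>.trans_le (Submodule.span_le.2 ?_)
  rintro _ ⟨_, ⟨a, b, s, hs, rfl⟩, _, ⟨c, d, z, hz, rfl⟩, rfl⟩
  have h₁ := mul_mem_idealGen_right d (mul_mem_idealGen_left (a * s)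
    (subset_idealGen (k := k) _ (commutator_mem_lcs_succ (n := n + 1) (b * c) hz)))
  have h₂ := mul_mem_idealGen_right (b * c * d)
    (mul_mem_idealGen_left a (mul_mem_idealGen_of_lcs hs hz))
  have key : a * s * b * (c * z * d) =
      a * s * (b * c * z - z * (b * c)) * d + a * (s * z) * (b * c * d) := by noncomm_ring
  change a * s * b * (c * z * d) ∈ Mser k A (n + 3)
  exact key ▸ add_mem h₁ h₂

theorem Mser_three_pow_le (n : ℕ) : Mser k A 3 ^ (n + 1) ≤ Mser k A (n + 3) := by
  induction n with
  | zero => simp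
  | succ n ih =>
    rw [pow_succ']
    exact (mul_le_mul_right ih _).trans (Mser_three_mul_Mser_le (n + 1))

/-- In a finitely generated algebra, some power of `M_2` is contained in `M_3`. -/
theorem exists_Mser_two_pow_le_Mser_three {ι : Type*} [Fintype ι] {x : ι → A}
    (hx : Algebra.adjoin k (Set.range x) = ⊤) :
    ∃ N : ℕ, 1 ≤ N ∧ Mser k A 2 ^ N ≤ Mser k A 3 := by
  let π := Ideal.Quotient.mkₐ k (idealGenIdeal k (lcs k A 2 : Set A))
  have hπ : Function.Surjective π := Ideal.Quotient.mkₐ_surjective k _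
  have hcomm : ∀ a b r : A ⧸ idealGenIdeal k (lcs k A 2 : Set A),
      Commute (a * b - b * a) r := by
    intro a b r
    obtain ⟨a, rfl⟩ := hπ a
    obtain ⟨b, rfl⟩ := hπ b
    obtain ⟨r, rfl⟩ := hπ r
    refine Commute.symm (sub_eq_zero.1 ?_)
    simp only [← map_mul, ← map_sub]
    exact Ideal.Quotient.eq_zero_iff_mem.2 (subset_idealGen _
      (commutator_mem_lcs_succ r (commutator_mem_lcs_succ a Submodule.mem_top)))
  have hgen : Algebra.adjoin k (Set.range (π ∘ x)) = ⊤ := by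
    rw [Set.range_comp, ← AlgHom.map_adjoin, hx, Algebra.map_top]
    exact (AlgHom.range_eq_top π).2 hπ
  obtain ⟨S, ⟨N, hN⟩, hl, hr, hS⟩ := exists_nilpotent_of_commute_commutator hgen hcomm
  have hle : (Mser k A 2).map π.toLinearMap ≤ S := by
    refine Submodule.map_le_iff_le_comap.2 (Submodule.span_le.2 ?_)
    rintro _ ⟨a, b, s, hs, rfl⟩
    have hs' : lcs k A 1 ≤ S.comap π.toLinearMap := by
      refine Submodule.span_le.2 ?_
      rintro _ ⟨c, d, -, rfl⟩
      simpa using hS (π c) (π d)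
    simpa using hr (π b) _ (hl (π a) _ (hs' hs))
  refine ⟨N + 1, N.succ_pos, fun y hy => mem_idealGenIdeal.1 (Ideal.Quotient.eq_zero_iff_mem.1 ?_)⟩
  have hy' := Submodule.mem_map_of_mem (f := π.toLinearMap) hy
  rw [Submodule.map_pow] at hy'
  have hy'' := pow_le_pow_left' hle (N + 1) hy'
  rw [pow_succ, hN, zero_mul] at hy''
  exact hy''

end Mser

/-- For the free associative unital `ℂ`-algebra on `n` generators and `i ≥ 2`, there
exists `N ≥ 1` with `M_2(A_n)^N ⊆ M_i(A_n)`; equivalently, the image of `M_2(A_n)` in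
`Q_{n,i} = A_n/M_i(A_n)` is a nilpotent ideal. -/
theorem Mser_two_pow_le_Mser (n i : ℕ) (hi : 2 ≤ i) :
    ∃ N : ℕ, 1 ≤ N ∧
      Mser ℂ (FreeAlgebra ℂ (Fin n)) 2 ^ N ≤ Mser ℂ (FreeAlgebra ℂ (Fin n)) i := by
  obtain rfl | hi := hi.eq_or_lt
  · exact ⟨1, le_rfl, (pow_one _).le⟩
  obtain ⟨m, rfl⟩ := Nat.exists_eq_add_of_le' hi
  obtain ⟨N, hN, hle⟩ :=
    exists_Mser_two_pow_le_Mser_three (FreeAlgebra.adjoin_range_ι ℂ (Fin n))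
  refine ⟨N * (m + 1), Nat.mul_pos hN m.succ_pos, ?_⟩
  rw [pow_mul]
  exact (pow_le_pow_left' hle _).trans (Mser_three_pow_le m)
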